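/- Let n ≥ 1, λ ∈ ℂⁿ and γ ∈ ℂ with Re(γ + λᵢ) > 0 for all 1 ≤ i ≤ n. For x, y ∈ ℝ_{>0}ⁿ define the Baxter kernel Qⁿ_γ(x, y) = ( Π_{i=1}^n yᵢ/xᵢ )^γ · exp( − Σ_{i=1}^n yᵢ/xᵢ − Σ_{i=1}^{n−1} x_{i+1}/yᵢ ). Then for every y ∈ ℝ_{>0}ⁿ the function x ↦ Qⁿ_γ(x,y) Ψⁿ_λ(x) Π_{i=1}^n xᵢ^{−1} is absolutely integrable on ℝ_{>0}ⁿ and ∫_{ℝ_{>0}ⁿ} Qⁿ_γ(x, y) Ψⁿ_λ(x) Π_{i=1}^n dxᵢ/xᵢ = ( Π_{i=1}^n Γ(γ + λᵢ) ) · Ψⁿ_λ(y). (This is the Pieri-type identity of Theorem 5.4, due to Gerasimov–Lebedev–Oblezin: the Baxter operator Q_γ acts on the Whittaker function by the scalar Π Γ(γ ± λᵢ); here, in the stated normalization of Ψⁿ_λ — which carries the exponent −λ_k, so λ is replaced by −λ relative to conventions in which Ψ¹_λ(x) = x^{λ} — the scalar is Π Γ(γ + λᵢ).) -/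

import Mathlib

open MeasureTheory
open scoped BigOperators

noncomputable section

/-- Triangular Gelfand–Tsetlin-type arrays `(z_{k,j})` (0-based: rows
`k = 0, …, n−2`, row `k` having entries `j = 0, …, k`). -/
abbrev GTArray (n : ℕ) := (k : Fin (n - 1)) → Fin (k.1 + 1) → ℝ

/-- The entry `z_{k,j}` (0-based) of a triangular array, with the convention that
row `n−1` is given by `x`. Out-of-range indices (never used) yield `0`. -/
def Zent (n : ℕ) (x : Fin n → ℝ) (z : GTArray n) (k j : ℕ) : ℝ :=
  if hk : k < n - 1 then
    if hj : j < k + 1 then z ⟨k, hk⟩ ⟨j, hj⟩ else 0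
  else if hj : j < n then x ⟨j, hj⟩ else 0

/-- The superpotential/decoration
`F(z;x) = Σ_{0≤j≤k≤n−2} ( z_{k+1,j+1}/z_{k,j} + z_{k,j}/z_{k+1,j} )`
(0-based form of `Σ_{1≤j≤k≤n−1}` in 1-based indexing). -/
def Ffun (n : ℕ) (x : Fin n → ℝ) (z : GTArray n) : ℝ :=
  ∑ k ∈ Finset.range (n - 1), ∑ j ∈ Finset.range (k + 1),
    (Zent n x z (k + 1) (j + 1) / Zent n x z k j +
      Zent n x z k j / Zent n x z (k + 1) j)

/-- The weight
`w_λ(z;x) = Π_{k} ( Π_{j≤k} z_{k,j} / Π_{j≤k−1} z_{k−1,j} )^{−λ_k}`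
(0-based product over `k = 0, …, n−1`), with `t^s := exp(s·log t)` for `t > 0`. -/
def wfun (n : ℕ) (lam : Fin n → ℂ) (x : Fin n → ℝ) (z : GTArray n) : ℂ :=
  ∏ k ∈ Finset.range n,
    Complex.exp ((-(if hk : k < n then lam ⟨k, hk⟩ else 0)) *
      (Real.log ((∏ j ∈ Finset.range (k + 1), Zent n x z k j) /
        ∏ j ∈ Finset.range k, Zent n x z (k - 1) j) : ℂ))

/-- The positive orthant of triangular arrays. -/
def GTpos (n : ℕ) : Set (GTArray n) := {z | ∀ k j, 0 < z k j}

/-- The density `Π_{k,j} z_{k,j}⁻¹` of the measure `Π dz_{k,j}/z_{k,j}` with respect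
to Lebesgue measure. -/
def GTdens (n : ℕ) (z : GTArray n) : ℝ :=
  ∏ k : Fin (n - 1), ∏ j : Fin (k.1 + 1), (z k j)⁻¹

/-- The `GL(n)` Whittaker function
`Ψⁿ_λ(x) = ∫_{ℝ_{>0}^{n(n−1)/2}} w_λ(z;x) e^{−F(z;x)} Π dz_{k,j}/z_{k,j}`
(normalization of Corwin–O'Connell–Seppäläinen–Zygouras). -/
def Psi (n : ℕ) (lam : Fin n → ℂ) (x : Fin n → ℝ) : ℂ :=
  ∫ z in GTpos n,
    wfun n lam x z * (Real.exp (-Ffun n x z) : ℂ) * (GTdens n z : ℂ)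

end

/-- The Baxter kernel
`Qⁿ_γ(x,y) = (Π yᵢ/xᵢ)^γ · exp(−Σᵢ yᵢ/xᵢ − Σ_{i<n} x_{i+1}/yᵢ)`,
with `t^γ := exp(γ·log t)` for `t > 0` (0-based form of `Σ_{i=1}^{n−1} x_{i+1}/yᵢ`). -/
noncomputable def baxterQ (n : ℕ) (γ : ℂ) (x y : Fin n → ℝ) : ℂ :=
  Complex.exp (γ * (Real.log (∏ i, y i / x i) : ℂ)) *
    (Real.exp (-(∑ i, y i / x i) -
      ∑ i ∈ Finset.range (n - 1),
        (if hi : i + 1 < n then x ⟨i + 1, hi⟩ else 0) /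
          (if hi : i < n then y ⟨i, hi⟩ else 1)) : ℂ)

namespace Whittaker

open Set Function ENNReal

section LogCoordinates

theorem lintegral_fin_prod_eq_prod {n : ℕ} {E : Fin n → Type*} {mE : ∀ i, MeasurableSpace (E i)}
    {μ : (i : Fin n) → Measure (E i)} [∀ i, SigmaFinite (μ i)]
    {f : (i : Fin n) → E i → ℝ≥0∞} (hf : ∀ i, Measurable (f i)) :
    ∫⁻ x, ∏ i, f i (x i) ∂(Measure.pi μ) = ∏ i, ∫⁻ x, f i x ∂(μ i) := by
  induction n with
  | zero => simp
  | succ n ih =>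
    rw [← ((measurePreserving_piFinSuccAbove μ 0).symm).lintegral_comp_emb
      (MeasurableEquiv.measurableEmbedding _), Fin.prod_univ_succ, ← ih fun i => hf i.succ,
      ← lintegral_prod_mul (hf 0).aemeasurable]
    · refine lintegral_congr fun x => ?_
      rw [Fin.prod_univ_succ]
      rfl
    · exact (Finset.measurable_prod _ fun i _ =>
        (hf i.succ).comp (measurable_pi_apply i)).aemeasurable

theorem pi_withDensity {n : ℕ} {E : Fin n → Type*} {mE : ∀ i, MeasurableSpace (E i)}
    {μ : (i : Fin n) → Measure (E i)} [∀ i, SigmaFinite (μ i)]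
    {f : (i : Fin n) → E i → ℝ≥0∞} (hf : ∀ i, Measurable (f i))
    [∀ i, SigmaFinite ((μ i).withDensity (f i))] :
    Measure.pi (fun i => (μ i).withDensity (f i)) =
      (Measure.pi μ).withDensity fun x => ∏ i, f i (x i) := by
  refine Measure.pi_eq fun s hs => ?_
  rw [withDensity_apply _ (.univ_pi hs), Measure.restrict_pi_pi, lintegral_fin_prod_eq_prod hf]
  exact Finset.prod_congr rfl fun i _ => (withDensity_apply _ (hs i)).symm

theorem map_exp_volume :
    (volume : Measure ℝ).map Real.exp =
      (volume.restrict (Ioi 0)).withDensity fun x => ENNReal.ofReal x⁻¹ := by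
  have hm : Measurable fun x : ℝ => ENNReal.ofReal x⁻¹ := by fun_prop
  ext s hs
  rw [Measure.map_apply Real.measurable_exp hs, withDensity_apply _ hs,
    ← lintegral_indicator hs, ← Real.range_exp, ← image_univ,
    lintegral_image_eq_lintegral_abs_deriv_mul MeasurableSet.univ
      (fun x _ => (Real.hasDerivAt_exp x).hasDerivWithinAt) Real.exp_injective.injOn,
    setLIntegral_univ, ← lintegral_indicator_one (Real.measurable_exp hs)]
  refine lintegral_congr fun x => ?_
  by_cases hx : Real.exp x ∈ s
  · rw [indicator_of_mem (by exact hx), indicator_of_mem hx, abs_of_pos (Real.exp_pos x),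
      ← ENNReal.ofReal_mul (Real.exp_pos x).le, mul_inv_cancel₀ (Real.exp_pos x).ne']
    simp
  · rw [indicator_of_notMem (by exact hx), indicator_of_notMem hx, mul_zero]

instance : SigmaFinite ((volume : Measure ℝ).map Real.exp) := by
  rw [map_exp_volume]
  exact SigmaFinite.withDensity_ofReal _

theorem map_pi_exp_volume (n : ℕ) :
    (volume : Measure (Fin n → ℝ)).map (fun t i => Real.exp (t i)) =
      (volume.restrict {x | ∀ i, 0 < x i}).withDensity fun x => ENNReal.ofReal (∏ i, (x i)⁻¹) := by
  have hset : {x : Fin n → ℝ | ∀ i, 0 < x i} = univ.pi fun _ => Ioi 0 := by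
    ext; simp
  have (_ : Fin n) : SigmaFinite ((volume.restrict (Ioi (0 : ℝ))).withDensity
    fun x => ENNReal.ofReal x⁻¹) := SigmaFinite.withDensity_ofReal _
  rw [volume_pi, Measure.pi_map_pi fun _ => Real.measurable_exp.aemeasurable, map_exp_volume,
    pi_withDensity (fun _ => by fun_prop), hset, Measure.restrict_pi_pi]
  refine withDensity_congr_ae ?_
  rw [← Measure.restrict_pi_pi]
  refine (ae_restrict_mem (MeasurableSet.univ_pi fun _ => measurableSet_Ioi)).mono fun x hx => ?_
  exact (ENNReal.ofReal_prod_of_nonneg fun i _ => (inv_pos.2 (hx i trivial)).le).symm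

instance (n : ℕ) : SigmaFinite ((volume : Measure (Fin n → ℝ)).map fun t i => Real.exp (t i)) := by
  rw [map_pi_exp_volume]
  exact SigmaFinite.withDensity_ofReal _

theorem map_pi_pi_exp_volume (n : ℕ) :
    (volume : Measure (GTArray n)).map (fun t k j => Real.exp (t k j)) =
      (volume.restrict (GTpos n)).withDensity fun z => ENNReal.ofReal (GTdens n z) := by
  have hset : GTpos n = univ.pi fun k : Fin (n - 1) => {x : Fin (k.1 + 1) → ℝ | ∀ j, 0 < x j} := by
    ext; simp [GTpos]
  have hpos (k : Fin (n - 1)) : MeasurableSet {x : Fin (k.1 + 1) → ℝ | ∀ j, 0 < x j} := by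
    rw [Set.ofPred_forall]
    exact MeasurableSet.iInter fun i => measurableSet_lt measurable_const (measurable_pi_apply i)
  have (k : Fin (n - 1)) : SigmaFinite ((volume.restrict {x : Fin (k.1 + 1) → ℝ | ∀ i, 0 < x i}
    ).withDensity fun x => ENNReal.ofReal (∏ i, (x i)⁻¹)) := SigmaFinite.withDensity_ofReal _
  rw [volume_pi, Measure.pi_map_pi (f := fun (k : Fin (n - 1)) (t : Fin (k.1 + 1) → ℝ) i =>
    Real.exp (t i)) fun _ => Measurable.aemeasurable (by fun_prop)]
  simp_rw [map_pi_exp_volume]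
  rw [pi_withDensity (fun _ => by fun_prop), hset, Measure.restrict_pi_pi]
  refine withDensity_congr_ae ?_
  rw [← Measure.restrict_pi_pi]
  refine (ae_restrict_mem (MeasurableSet.univ_pi hpos)).mono fun x hx => ?_
  exact (ENNReal.ofReal_prod_of_nonneg fun k _ =>
    Finset.prod_nonneg fun i _ => (inv_pos.2 (hx k trivial i)).le).symm

theorem measurableEmbedding_pi_exp (n : ℕ) :
    MeasurableEmbedding fun (t : Fin n → ℝ) i => Real.exp (t i) :=
  Continuous.measurableEmbedding (by fun_prop) fun s t h => funext fun i =>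
    Real.exp_injective (congrFun h i)

theorem measurableEmbedding_pi_pi_exp (n : ℕ) :
    MeasurableEmbedding fun (t : GTArray n) k j => Real.exp (t k j) :=
  Continuous.measurableEmbedding (by fun_prop) fun s t h => funext fun k => funext fun j =>
    Real.exp_injective (congrFun (congrFun h k) j)

/-- Change of variables `x = exp t`, stated for an embedding `e` pushing `μ` forward to a measure
with a positive density. -/
theorem setIntegral_mul_density {α : Type*} [MeasurableSpace α] {μ ν : Measure α} {e : α → α}
    (he : MeasurableEmbedding e) {s : Set α} (hs : MeasurableSet s) {d : α → ℝ}
    (hd : Measurable d) (hd0 : ∀ x ∈ s, 0 ≤ d x)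
    (h : μ.map e = (ν.restrict s).withDensity fun x => ENNReal.ofReal (d x)) (f : α → ℂ) :
    (IntegrableOn (fun x => f x * (d x : ℂ)) s ν ↔ Integrable (fun t => f (e t)) μ) ∧
      ∫ x in s, f x * (d x : ℂ) ∂ν = ∫ t, f (e t) ∂μ := by
  have hm : Measurable fun x => ENNReal.ofReal (d x) := by fun_prop
  have hlt : ∀ᵐ x ∂ν.restrict s, ENNReal.ofReal (d x) < ∞ := by simp
  have hcongr : (fun x => (ENNReal.ofReal (d x)).toReal • f x) =ᵐ[ν.restrict s]
      fun x => f x * (d x : ℂ) := by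
    refine (ae_restrict_mem hs).mono fun x hx => ?_
    simp only [ENNReal.toReal_ofReal (hd0 x hx), Complex.real_smul, mul_comm]
  constructor
  · rw [IntegrableOn, ← integrable_congr hcongr,
      ← integrable_withDensity_iff_integrable_smul' hm hlt,
      ← h, he.integrable_map_iff]
    rfl
  · rw [← integral_congr_ae hcongr, ← integral_withDensity_eq_integral_toReal_smul hm hlt, ← h,
      he.integral_map]

end LogCoordinates

section OneVariable

/-- The integrand of Macdonald's integral, in the logarithmic coordinate `u`. -/
noncomputable def macdonald (s : ℂ) (a b u : ℝ) : ℂ :=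
  Complex.exp (s * u - ((a * Real.exp (-u) + b * Real.exp u : ℝ) : ℂ))

theorem continuous_macdonald (s : ℂ) (a b : ℝ) : Continuous (macdonald s a b) := by
  unfold macdonald
  fun_prop

theorem enorm_cexp (z : ℂ) : ‖Complex.exp z‖ₑ = ENNReal.ofReal (Real.exp z.re) := by
  rw [← ofReal_norm, Complex.norm_exp]

theorem norm_macdonald (s : ℂ) (a b u : ℝ) :
    ‖macdonald s a b u‖ = Real.exp (s.re * u - (a * Real.exp (-u) + b * Real.exp u)) := by
  rw [macdonald, Complex.norm_exp, Complex.sub_re, Complex.re_mul_ofReal, Complex.ofReal_re]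

theorem macdonald_zero_one_eq (s : ℂ) (u : ℝ) :
    macdonald s 0 1 u = ((-Real.exp u).exp : ℂ) * (Real.exp u : ℂ) ^ (s - 1) * Real.exp u := by
  have h0 : (Real.exp u : ℂ) ≠ 0 := by exact_mod_cast (Real.exp_pos u).ne'
  rw [mul_assoc, Complex.cpow_sub _ _ h0, Complex.cpow_one, div_mul_cancel₀ _ h0,
    Complex.cpow_def_of_ne_zero h0, ← Complex.ofReal_log (Real.exp_pos u).le, Real.log_exp,
    macdonald, sub_eq_neg_add, Complex.exp_add, mul_comm s]
  push_cast
  simp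

theorem macdonald_zero_one {s : ℂ} (hs : 0 < s.re) :
    Integrable (macdonald s 0 1) ∧ ∫ u, macdonald s 0 1 u = Complex.Gamma s := by
  have key := setIntegral_mul_density (μ := volume) (ν := volume)
    (Real.continuous_exp.measurableEmbedding Real.exp_injective) measurableSet_Ioi measurable_inv
    (fun x hx => (inv_pos.2 hx).le) map_exp_volume
    fun x => ((-x).exp : ℂ) * (x : ℂ) ^ (s - 1) * x
  simp_rw [← macdonald_zero_one_eq] at key
  have hcongr : EqOn (fun x : ℝ => ((-x).exp : ℂ) * (x : ℂ) ^ (s - 1) * x * ((x⁻¹ : ℝ) : ℂ))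
      (fun x => ((-x).exp : ℂ) * (x : ℂ) ^ (s - 1)) (Ioi 0) := fun x hx => by
    have h0 : (x : ℂ) ≠ 0 := by exact_mod_cast (mem_Ioi.1 hx).ne'
    simp only [Complex.ofReal_inv, mul_assoc, mul_inv_cancel₀ h0, mul_one]
  rw [integrableOn_congr_fun hcongr measurableSet_Ioi,
    setIntegral_congr_fun measurableSet_Ioi hcongr] at key
  refine ⟨key.1.1 (Complex.GammaIntegral_convergent hs), ?_⟩
  rw [Complex.Gamma_eq_integral hs, Complex.GammaIntegral, ← key.2]

theorem macdonald_neg_sub (s : ℂ) {a b : ℝ} (ha : 0 < a) (hb : 0 < b) (u : ℝ) :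
    macdonald (-s) a b (Real.log a - Real.log b - u) =
      Complex.exp (-s * ((Real.log a - Real.log b : ℝ) : ℂ)) * macdonald s a b u := by
  have h1 : a * Real.exp (-(Real.log a - Real.log b - u)) = b * Real.exp u := by
    rw [show -(Real.log a - Real.log b - u) = Real.log b - Real.log a + u by ring, Real.exp_add,
      Real.exp_sub, Real.exp_log ha, Real.exp_log hb]
    field_simp
  have h2 : b * Real.exp (Real.log a - Real.log b - u) = a * Real.exp (-u) := by
    rw [sub_eq_add_neg _ u, Real.exp_add, Real.exp_sub, Real.exp_log ha, Real.exp_log hb]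
    field_simp
  rw [macdonald, macdonald, h1, h2, ← Complex.exp_add]
  congr 1
  push_cast
  ring

theorem macdonald_neg_zero_sub (s : ℂ) {a : ℝ} (ha : 0 < a) (u : ℝ) :
    macdonald (-s) a 0 (Real.log a - u) =
      Complex.exp (-s * (Real.log a : ℂ)) * macdonald s 0 1 u := by
  have h1 : a * Real.exp (-(Real.log a - u)) = Real.exp u := by
    rw [neg_sub, Real.exp_sub, Real.exp_log ha, mul_div_cancel₀ _ ha.ne']
  rw [macdonald, macdonald, h1, ← Complex.exp_add]
  congr 1
  push_cast
  ring

theorem macdonald_zero_exp_sub (s : ℂ) (β u : ℝ) :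
    macdonald s 0 (Real.exp β) (u - β) = Complex.exp (-s * β) * macdonald s 0 1 u := by
  rw [macdonald, macdonald, ← Real.exp_add, ← Complex.exp_add]
  congr 1
  push_cast
  ring_nf

/-- The mass of Macdonald's integrand is bounded by a monomial in its two parameters. -/
theorem exists_lintegral_macdonald_le (s : ℂ) :
    ∃ D p q : ℝ, 0 ≤ D ∧ ∀ α β : ℝ,
      ∫⁻ u, ‖macdonald s (Real.exp α) (Real.exp β) u‖ₑ ≤
        ENNReal.ofReal (D * Real.exp (p * α + q * β)) := by
  obtain ⟨m, hm⟩ := exists_nat_gt (-s.re)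
  have hs : 0 < (s + m).re := by simpa using by linarith
  obtain ⟨I, hI, hI0⟩ : ∃ I : ℝ, ∫⁻ u, ‖macdonald (s + m) 0 1 u‖ₑ = ENNReal.ofReal I ∧ 0 ≤ I :=
    ⟨_, (ofReal_integral_norm_eq_lintegral_enorm (macdonald_zero_one hs).1).symm,
      integral_nonneg fun _ => norm_nonneg _⟩
  refine ⟨m.factorial * I, -m, -(s + m).re, by positivity, fun α β => ?_⟩
  have hpt (u : ℝ) : ‖macdonald s (Real.exp α) (Real.exp β) u‖ₑ ≤
      ENNReal.ofReal (m.factorial * Real.exp (-m * α)) *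
        ‖macdonald (s + m) 0 (Real.exp β) u‖ₑ := by
    rw [← ofReal_norm, ← ofReal_norm, ← ENNReal.ofReal_mul (by positivity)]
    refine ENNReal.ofReal_le_ofReal ?_
    rw [norm_macdonald, norm_macdonald, ← Real.exp_add]
    have h := Real.pow_div_factorial_le_exp _ (Real.exp_pos (α - u)).le m
    rw [← Real.exp_nat_mul, div_le_iff₀ (by positivity)] at h
    calc _ = Real.exp (m * (α - u)) * Real.exp (s.re * u - Real.exp (α - u)
              - Real.exp β * Real.exp u - m * (α - u)) := by
            rw [← Real.exp_add, ← Real.exp_add]; ring_nf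
      _ ≤ (Real.exp (Real.exp (α - u)) * m.factorial) * Real.exp (s.re * u - Real.exp (α - u)
              - Real.exp β * Real.exp u - m * (α - u)) := by gcongr
      _ = m.factorial * (Real.exp (Real.exp (α - u)) * Real.exp (s.re * u - Real.exp (α - u)
              - Real.exp β * Real.exp u - m * (α - u))) := by ring
      _ = _ := by
        simp only [mul_assoc, ← Real.exp_add, Complex.add_re, Complex.natCast_re]
        ring_nf
  calc _ ≤ ∫⁻ u, ENNReal.ofReal (m.factorial * Real.exp (-m * α)) *
        ‖macdonald (s + m) 0 (Real.exp β) u‖ₑ := lintegral_mono hpt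
    _ = ENNReal.ofReal (m.factorial * Real.exp (-m * α)) *
        ∫⁻ u, ‖macdonald (s + m) 0 (Real.exp β) (u - β)‖ₑ := by
      rw [lintegral_const_mul' _ _ ENNReal.ofReal_ne_top,
        lintegral_sub_right_eq_self fun u => ‖macdonald (s + m) 0 (Real.exp β) u‖ₑ]
    _ = _ := by
      simp_rw [macdonald_zero_exp_sub, enorm_mul, enorm_cexp]
      rw [lintegral_const_mul' _ _ ENNReal.ofReal_ne_top, hI, ← ENNReal.ofReal_mul (by positivity),
        ← ENNReal.ofReal_mul (by positivity)]
      congr 1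
      rw [Real.exp_add, Complex.re_mul_ofReal, Complex.neg_re]
      ring

theorem integrable_macdonald (s : ℂ) {a b : ℝ} (ha : 0 < a) (hb : 0 < b) :
    Integrable (macdonald s a b) := by
  obtain ⟨D, p, q, -, h⟩ := exists_lintegral_macdonald_le s
  refine ⟨(continuous_macdonald s a b).aestronglyMeasurable, ?_⟩
  have := h (Real.log a) (Real.log b)
  rw [Real.exp_log ha, Real.exp_log hb] at this
  exact this.trans_lt ENNReal.ofReal_lt_top

theorem integral_macdonald_neg (s : ℂ) {a b : ℝ} (ha : 0 < a) (hb : 0 < b) :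
    ∫ u, macdonald (-s) a b u =
      Complex.exp (-s * ((Real.log a - Real.log b : ℝ) : ℂ)) * ∫ u, macdonald s a b u := by
  rw [← integral_sub_left_eq_self _ volume (Real.log a - Real.log b), ← integral_const_mul]
  exact integral_congr_ae (.of_forall (macdonald_neg_sub s ha hb))

theorem macdonald_neg_zero {s : ℂ} (hs : 0 < s.re) {a : ℝ} (ha : 0 < a) :
    Integrable (macdonald (-s) a 0) ∧
      ∫ u, macdonald (-s) a 0 u = Complex.exp (-s * (Real.log a : ℂ)) * Complex.Gamma s := by
  have h : (fun u => macdonald (-s) a 0 (Real.log a - u)) =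
      fun u => Complex.exp (-s * (Real.log a : ℂ)) * macdonald s 0 1 u :=
    funext (macdonald_neg_zero_sub s ha)
  constructor
  · rw [← integrable_comp_sub_left _ (Real.log a), h]
    exact (macdonald_zero_one hs).1.const_mul _
  · rw [← integral_sub_left_eq_self _ volume (Real.log a), h, integral_const_mul,
      (macdonald_zero_one hs).2]

end OneVariable

section Kernels

variable {n : ℕ}

/-- The coordinate `exp (x i)`, extended by `0` to indices out of range. -/
noncomputable def expEntry (x : Fin n → ℝ) (i : ℕ) : ℝ :=
  if h : i < n then Real.exp (x ⟨i, h⟩) else 0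

@[simp]
theorem expEntry_val (x : Fin n → ℝ) (i : Fin n) : expEntry x i = Real.exp (x i) := by
  simp [expEntry]

@[simp]
theorem expEntry_self (x : Fin n → ℝ) : expEntry x n = 0 := by
  simp [expEntry]

@[simp]
theorem expEntry_val_add_one (x : Fin (n + 1) → ℝ) (i : Fin n) :
    expEntry x (i + 1) = Real.exp (x i.succ) :=
  expEntry_val x i.succ

theorem expEntry_nonneg (x : Fin n → ℝ) (i : ℕ) : 0 ≤ expEntry x i := by
  unfold expEntry
  split_ifs <;> positivity

@[fun_prop]
theorem continuous_expEntry (i : ℕ) : Continuous fun x : Fin n → ℝ => expEntry x i := by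
  unfold expEntry
  split_ifs <;> fun_prop

/-- The Baxter kernel in logarithmic coordinates. -/
noncomputable def baxterKernel (γ : ℂ) (x y : Fin n → ℝ) : ℂ :=
  Complex.exp (γ * ((∑ i, y i - ∑ i, x i : ℝ) : ℂ) -
    ((∑ i, (Real.exp (y i - x i) + expEntry x (i + 1) * Real.exp (-y i)) : ℝ) : ℂ))

/-- The kernel of the recursion from `GL(n)` to `GL(n + 1)` Whittaker functions, in logarithmic
coordinates. -/
noncomputable def recKernel (l : ℂ) (x : Fin (n + 1) → ℝ) (z : Fin n → ℝ) : ℂ :=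
  Complex.exp (l * ((∑ i, z i - ∑ i, x i : ℝ) : ℂ) -
    ((∑ i, (Real.exp (x i.succ - z i) + Real.exp (z i - x i.castSucc)) : ℝ) : ℂ))

@[fun_prop]
theorem continuous_baxterKernel {X : Type*} [TopologicalSpace X] (γ : ℂ) {f g : X → Fin n → ℝ}
    (hf : Continuous f) (hg : Continuous g) : Continuous fun a => baxterKernel γ (f a) (g a) := by
  unfold baxterKernel
  have (i : Fin n) : Continuous fun a => expEntry (f a) (i + 1) := (continuous_expEntry _).comp hf
  fun_prop

@[fun_prop]
theorem continuous_recKernel {X : Type*} [TopologicalSpace X] (l : ℂ) {f : X → Fin (n + 1) → ℝ}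
    {g : X → Fin n → ℝ} (hf : Continuous f) (hg : Continuous g) :
    Continuous fun a => recKernel l (f a) (g a) := by
  unfold recKernel
  fun_prop

theorem ofReal_norm_baxterKernel (γ : ℂ) (x y : Fin n → ℝ) :
    (‖baxterKernel γ x y‖ : ℂ) = baxterKernel γ.re x y := by
  simp only [baxterKernel, Complex.norm_exp, Complex.sub_re, Complex.re_mul_ofReal,
    Complex.ofReal_re]
  push_cast
  rfl

theorem ofReal_norm_recKernel (l : ℂ) (x : Fin (n + 1) → ℝ) (z : Fin n → ℝ) :
    (‖recKernel l x z‖ : ℂ) = recKernel l.re x z := by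
  simp only [recKernel, Complex.norm_exp, Complex.sub_re, Complex.re_mul_ofReal,
    Complex.ofReal_re]
  push_cast
  rfl

/-- The coefficient of `exp (-x i)` in `baxterKernel γ x y * recKernel l x z`. -/
noncomputable def downCoeff (y : Fin (n + 1) → ℝ) (z : Fin n → ℝ) (i : Fin (n + 1)) : ℝ :=
  Real.exp (y i) + expEntry z i

/-- The coefficient of `exp (x i.succ)` in `baxterKernel γ x y * recKernel l x z`. -/
noncomputable def upCoeff (y : Fin (n + 1) → ℝ) (z : Fin n → ℝ) (i : Fin n) : ℝ :=
  Real.exp (-y i.castSucc) + Real.exp (-z i)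

theorem downCoeff_pos (y : Fin (n + 1) → ℝ) (z : Fin n → ℝ) (i : Fin (n + 1)) :
    0 < downCoeff y z i :=
  add_pos_of_pos_of_nonneg (Real.exp_pos _) (expEntry_nonneg z i)

theorem upCoeff_pos (y : Fin (n + 1) → ℝ) (z : Fin n → ℝ) (i : Fin n) : 0 < upCoeff y z i :=
  add_pos (Real.exp_pos _) (Real.exp_pos _)

theorem log_upCoeff (y : Fin (n + 1) → ℝ) (z : Fin n → ℝ) (i : Fin n) :
    Real.log (upCoeff y z i) = Real.log (downCoeff y z i.castSucc) - y i.castSucc - z i := by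
  have h : upCoeff y z i = downCoeff y z i.castSucc * Real.exp (-y i.castSucc - z i) := by
    simp only [upCoeff, downCoeff, Fin.val_castSucc, expEntry_val, add_mul, ← Real.exp_add]
    ring_nf
  rw [h, Real.log_mul (downCoeff_pos y z _).ne' (Real.exp_pos _).ne', Real.log_exp]
  ring

theorem log_downCoeff_add_sum (y : Fin (n + 1) → ℝ) (z : Fin n → ℝ) :
    Real.log (downCoeff y z 0) +
      ∑ i : Fin n, (Real.log (downCoeff y z i.succ) - Real.log (upCoeff y z i)) =
        ∑ i, y i + ∑ i, z i := by
  have hlast : Real.log (downCoeff y z (Fin.last n)) = y (Fin.last n) := by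
    simp [downCoeff]
  have h := (Fin.sum_univ_succ fun i => Real.log (downCoeff y z i)).symm.trans
    (Fin.sum_univ_castSucc fun i => Real.log (downCoeff y z i))
  simp only [log_upCoeff, Finset.sum_sub_distrib, Fin.sum_univ_castSucc y]
  linarith

theorem baxterKernel_mul_recKernel (γ l : ℂ) (x y : Fin (n + 1) → ℝ) (z : Fin n → ℝ) :
    baxterKernel γ x y * recKernel l x z =
      Complex.exp (γ * ((∑ i, y i : ℝ) : ℂ) + l * ((∑ i, z i : ℝ) : ℂ)) *
        ∏ i, macdonald (-(γ + l)) (downCoeff y z i)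
          ((Fin.cons 0 (upCoeff y z) : Fin (n + 1) → ℝ) i) (x i) := by
  have h : ∑ i, (Real.exp (y i - x i) + expEntry x (i + 1) * Real.exp (-y i)) +
      ∑ i : Fin n, (Real.exp (x i.succ - z i) + Real.exp (z i - x i.castSucc)) =
      ∑ i, (downCoeff y z i * Real.exp (-x i) +
        (Fin.cons 0 (upCoeff y z) : Fin (n + 1) → ℝ) i * Real.exp (x i)) := by
    simp only [downCoeff, add_mul, Finset.sum_add_distrib]
    rw [Fin.sum_univ_castSucc fun i : Fin (n + 1) => expEntry x (i + 1) * Real.exp (-y i),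
      Fin.sum_univ_castSucc fun i : Fin (n + 1) => expEntry z i * Real.exp (-x i),
      Fin.sum_univ_succ fun i : Fin (n + 1) =>
        (Fin.cons 0 (upCoeff y z) : Fin (n + 1) → ℝ) i * Real.exp (x i)]
    simp only [Fin.cons_zero, Fin.cons_succ, upCoeff, Fin.val_castSucc, expEntry_val_add_one,
      Fin.val_last, expEntry_self, expEntry_val, ← Real.exp_add, add_mul, Finset.sum_add_distrib]
    simp only [sub_eq_add_neg, add_comm, zero_mul, zero_add]
    ring
  simp only [baxterKernel, recKernel, macdonald]
  rw [← Complex.exp_sum, ← Complex.exp_add, ← Complex.exp_add]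
  congr 1
  rw [Finset.sum_sub_distrib, ← Finset.mul_sum, ← Complex.ofReal_sum, ← Complex.ofReal_sum, ← h]
  push_cast
  ring

theorem recKernel_mul_baxterKernel (γ l : ℂ) (y : Fin (n + 1) → ℝ) (u z : Fin n → ℝ) :
    recKernel l y u * baxterKernel γ z u =
      Complex.exp (-l * ((∑ i, y i : ℝ) : ℂ) - γ * ((∑ i, z i : ℝ) : ℂ)) *
        ∏ i, macdonald (γ + l) (downCoeff y z i.succ) (upCoeff y z i) (u i) := by
  have h : ∑ i : Fin n, (Real.exp (y i.succ - u i) + Real.exp (u i - y i.castSucc)) +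
      ∑ i, (Real.exp (u i - z i) + expEntry z (i + 1) * Real.exp (-u i)) =
      ∑ i, (downCoeff y z i.succ * Real.exp (-u i) + upCoeff y z i * Real.exp (u i)) := by
    rw [← Finset.sum_add_distrib]
    refine Finset.sum_congr rfl fun i _ => ?_
    simp only [downCoeff, upCoeff, Fin.val_succ, add_mul, ← Real.exp_add]
    ring_nf
  simp only [baxterKernel, recKernel, macdonald]
  rw [← Complex.exp_sum, ← Complex.exp_add, ← Complex.exp_add]
  congr 1
  rw [Finset.sum_sub_distrib, ← Finset.mul_sum, ← Complex.ofReal_sum, ← Complex.ofReal_sum, ← h]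
  push_cast
  ring

theorem integrable_baxterKernel_mul_recKernel {γ l : ℂ} (h : 0 < (γ + l).re)
    (y : Fin (n + 1) → ℝ) (z : Fin n → ℝ) :
    Integrable fun x => baxterKernel γ x y * recKernel l x z := by
  simp_rw [baxterKernel_mul_recKernel]
  refine (Integrable.fintype_prod (f := fun i => macdonald (-(γ + l)) (downCoeff y z i)
    ((Fin.cons 0 (upCoeff y z) : Fin (n + 1) → ℝ) i)) fun i => ?_).const_mul _
  cases i using Fin.cases with
  | zero => exact (macdonald_neg_zero h (downCoeff_pos y z 0)).1
  | succ i => exact integrable_macdonald _ (downCoeff_pos y z _) (upCoeff_pos y z i)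

theorem integrable_recKernel_mul_baxterKernel (γ l : ℂ) (y : Fin (n + 1) → ℝ) (z : Fin n → ℝ) :
    Integrable fun u => recKernel l y u * baxterKernel γ z u := by
  simp_rw [recKernel_mul_baxterKernel]
  have key : Integrable fun u : Fin n → ℝ =>
      ∏ i, macdonald (γ + l) (downCoeff y z i.succ) (upCoeff y z i) (u i) :=
    Integrable.fintype_prod fun i =>
      integrable_macdonald _ (downCoeff_pos y z _) (upCoeff_pos y z i)
  exact key.const_mul _

/-- The Baxter operator intertwines with the recursion operator of Whittaker functions. -/
theorem integral_baxterKernel_mul_recKernel {γ l : ℂ} (h : 0 < (γ + l).re)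
    (y : Fin (n + 1) → ℝ) (z : Fin n → ℝ) :
    ∫ x, baxterKernel γ x y * recKernel l x z =
      Complex.Gamma (γ + l) * ∫ u, recKernel l y u * baxterKernel γ z u := by
  simp_rw [baxterKernel_mul_recKernel, recKernel_mul_baxterKernel, integral_const_mul]
  rw [integral_fintype_prod_volume_eq_prod fun i => macdonald (-(γ + l)) (downCoeff y z i)
      ((Fin.cons 0 (upCoeff y z) : Fin (n + 1) → ℝ) i),
    integral_fintype_prod_volume_eq_prod fun i => macdonald (γ + l) (downCoeff y z i.succ)
      (upCoeff y z i), Fin.prod_univ_succ]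
  simp only [Fin.cons_zero, Fin.cons_succ]
  simp_rw [(macdonald_neg_zero h (downCoeff_pos y z 0)).2,
    integral_macdonald_neg _ (downCoeff_pos y z _) (upCoeff_pos y z _)]
  rw [Finset.prod_mul_distrib, ← Complex.exp_sum]
  have key : Complex.exp (γ * ((∑ i, y i : ℝ) : ℂ) + l * ((∑ i, z i : ℝ) : ℂ)) *
      (Complex.exp (-(γ + l) * (Real.log (downCoeff y z 0) : ℂ)) *
        Complex.exp (∑ i : Fin n, -(γ + l) * ((Real.log (downCoeff y z i.succ) -
          Real.log (upCoeff y z i) : ℝ) : ℂ))) =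
      Complex.exp (-l * ((∑ i, y i : ℝ) : ℂ) - γ * ((∑ i, z i : ℝ) : ℂ)) := by
    rw [← Complex.exp_add, ← Complex.exp_add, ← Finset.mul_sum, ← mul_add, ← Complex.ofReal_sum,
      ← Complex.ofReal_add, log_downCoeff_add_sum]
    congr 1
    push_cast
    ring
  rw [← key]
  ring

theorem lintegral_baxterKernel_mul_recKernel {γ l : ℂ} (h : 0 < (γ + l).re)
    (y : Fin (n + 1) → ℝ) (z : Fin n → ℝ) :
    ∫⁻ x, ‖baxterKernel γ x y‖ₑ * ‖recKernel l x z‖ₑ =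
      ENNReal.ofReal (Real.Gamma (γ + l).re) *
        ∫⁻ u, ‖recKernel l y u‖ₑ * ‖baxterKernel γ z u‖ₑ := by
  have key : ∫ x, ‖baxterKernel γ x y * recKernel l x z‖ =
      Real.Gamma (γ + l).re * ∫ u, ‖recKernel l y u * baxterKernel γ z u‖ := by
    apply Complex.ofReal_injective
    rw [Complex.ofReal_mul, ← Complex.Gamma_ofReal, ← integral_complex_ofReal,
      ← integral_complex_ofReal]
    simp only [norm_mul, Complex.ofReal_mul, ofReal_norm_baxterKernel, ofReal_norm_recKernel,
      Complex.add_re, Complex.ofReal_add]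
    exact integral_baxterKernel_mul_recKernel (by simpa using h) y z
  simp_rw [← enorm_mul]
  rw [← ofReal_integral_norm_eq_lintegral_enorm (integrable_baxterKernel_mul_recKernel h y z),
    ← ofReal_integral_norm_eq_lintegral_enorm (integrable_recKernel_mul_baxterKernel γ l y z),
    ← ENNReal.ofReal_mul (Real.Gamma_pos_of_pos h).le, key]

end Kernels

section Whittaker

/-- Whittaker functions in logarithmic coordinates, defined by recursion on the rank. -/
noncomputable def whittaker : (n : ℕ) → (Fin n → ℂ) → (Fin n → ℝ) → ℂ
  | 0, _, _ => 1
  | n + 1, lam, x =>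
    ∫ z, recKernel (lam (Fin.last n)) x z * whittaker n (fun i => lam i.castSucc) z

/-- The recursion of Whittaker functions with all integrands replaced by their norms. -/
noncomputable def whittakerMajorant : (n : ℕ) → (Fin n → ℂ) → (Fin n → ℝ) → ℝ≥0∞
  | 0, _, _ => 1
  | n + 1, lam, x =>
    ∫⁻ z, ‖recKernel (lam (Fin.last n)) x z‖ₑ * whittakerMajorant n (fun i => lam i.castSucc) z

theorem measurable_whittakerMajorant (n : ℕ) (lam : Fin n → ℂ) :
    Measurable (whittakerMajorant n lam) := by
  cases n with
  | zero => exact measurable_const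
  | succ n =>
    have ih := measurable_whittakerMajorant n fun i => lam i.castSucc
    exact Measurable.lintegral_prod_right'
      (f := fun p : (Fin (n + 1) → ℝ) × (Fin n → ℝ) =>
        ‖recKernel (lam (Fin.last n)) p.1 p.2‖ₑ * whittakerMajorant n (fun i => lam i.castSucc) p.2)
      ((Continuous.measurable (by fun_prop)).enorm.mul (ih.comp measurable_snd))

theorem stronglyMeasurable_whittaker (n : ℕ) (lam : Fin n → ℂ) :
    StronglyMeasurable (whittaker n lam) := by
  cases n with
  | zero => exact stronglyMeasurable_const
  | succ n =>
    have ih := stronglyMeasurable_whittaker n fun i => lam i.castSucc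
    exact StronglyMeasurable.integral_prod_right'
      (f := fun p : (Fin (n + 1) → ℝ) × (Fin n → ℝ) =>
        recKernel (lam (Fin.last n)) p.1 p.2 * whittaker n (fun i => lam i.castSucc) p.2)
      ((Continuous.stronglyMeasurable (by fun_prop)).mul (ih.comp_measurable measurable_snd))

theorem enorm_whittaker_le (n : ℕ) (lam : Fin n → ℂ) (x : Fin n → ℝ) :
    ‖whittaker n lam x‖ₑ ≤ whittakerMajorant n lam x := by
  induction n with
  | zero => simp [whittaker, whittakerMajorant]
  | succ n ih =>
    refine (enorm_integral_le_lintegral_enorm _).trans (lintegral_mono fun z => ?_)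
    rw [enorm_mul]
    gcongr
    exact ih _ z

theorem enorm_recKernel_mul_monomial {n : ℕ} (l : ℂ) (p : Fin n → ℝ) (x : Fin (n + 1) → ℝ)
    (z : Fin n → ℝ) :
    ‖recKernel l x z‖ₑ * ENNReal.ofReal (Real.exp (∑ i, p i * z i)) =
      ENNReal.ofReal (Real.exp (-l.re * ∑ i, x i)) * ∏ i,
        ‖macdonald (l + p i) (Real.exp (x i.succ)) (Real.exp (-x i.castSucc)) (z i)‖ₑ := by
  simp only [macdonald, recKernel, enorm_cexp]
  rw [← ENNReal.ofReal_prod_of_nonneg fun i _ => (Real.exp_pos _).le, ← Real.exp_sum,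
    ← ENNReal.ofReal_mul (Real.exp_pos _).le, ← ENNReal.ofReal_mul (Real.exp_pos _).le,
    ← Real.exp_add, ← Real.exp_add]
  congr 2
  simp only [Complex.sub_re, Complex.re_mul_ofReal, Complex.ofReal_re, Complex.add_re]
  have hsub (i : Fin n) : Real.exp (z i - x i.castSucc) =
      Real.exp (-x i.castSucc) * Real.exp (z i) := by rw [← Real.exp_add, neg_add_eq_sub]
  simp only [hsub, sub_eq_add_neg (x _) (z _), Real.exp_add, add_mul, Finset.sum_sub_distrib,
    Finset.sum_add_distrib, ← Finset.mul_sum]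
  ring

theorem exists_whittakerMajorant_le (n : ℕ) (lam : Fin n → ℂ) :
    ∃ (C : ℝ) (p : Fin n → ℝ), 0 ≤ C ∧ ∀ x, whittakerMajorant n lam x ≤
      ENNReal.ofReal (C * Real.exp (∑ i, p i * x i)) := by
  induction n with
  | zero => exact ⟨1, 0, zero_le_one, by simp [whittakerMajorant]⟩
  | succ n ih =>
    obtain ⟨C, p, hC, h⟩ := ih fun i => lam i.castSucc
    set l := lam (Fin.last n)
    choose D a b hD hM using fun i => exists_lintegral_macdonald_le (l + p i)
    refine ⟨C * ∏ i, D i, fun i => -l.re + (Fin.cons 0 a : Fin (n + 1) → ℝ) i -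
      (Fin.snoc b 0 : Fin (n + 1) → ℝ) i, mul_nonneg hC (Finset.prod_nonneg fun i _ => hD i),
      fun x => ?_⟩
    calc whittakerMajorant (n + 1) lam x
        ≤ ∫⁻ z : Fin n → ℝ, ENNReal.ofReal C * (ENNReal.ofReal (Real.exp (-l.re * ∑ i, x i)) *
            ∏ i, ‖macdonald (l + p i) (Real.exp (x i.succ))
              (Real.exp (-x i.castSucc)) (z i)‖ₑ) := by
          refine lintegral_mono fun z => ?_
          rw [← enorm_recKernel_mul_monomial, mul_left_comm, ← ENNReal.ofReal_mul hC]
          gcongr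
          exact h z
      _ = ENNReal.ofReal C * (ENNReal.ofReal (Real.exp (-l.re * ∑ i, x i)) *
            ∏ i, ∫⁻ u, ‖macdonald (l + p i) (Real.exp (x i.succ))
              (Real.exp (-x i.castSucc)) u‖ₑ) := by
          rw [lintegral_const_mul' _ _ ENNReal.ofReal_ne_top,
            lintegral_const_mul' _ _ ENNReal.ofReal_ne_top, volume_pi,
            lintegral_fin_prod_eq_prod fun i => (continuous_macdonald _ _ _).measurable.enorm]
      _ ≤ ENNReal.ofReal C * (ENNReal.ofReal (Real.exp (-l.re * ∑ i, x i)) *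
            ∏ i, ENNReal.ofReal (D i * Real.exp (a i * x i.succ + b i * -x i.castSucc))) := by
          gcongr with i
          exact hM i _ _
      _ = _ := by
          rw [← ENNReal.ofReal_prod_of_nonneg fun i _ => mul_nonneg (hD i) (Real.exp_pos _).le,
            ← ENNReal.ofReal_mul (Real.exp_pos _).le, ← ENNReal.ofReal_mul hC,
            Finset.prod_mul_distrib, ← Real.exp_sum, mul_left_comm (Real.exp _), ← Real.exp_add,
            ← mul_assoc]
          congr 3
          simp only [sub_mul, add_mul, Finset.sum_sub_distrib, Finset.sum_add_distrib,
            ← Finset.mul_sum]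
          rw [Fin.sum_univ_succ fun i => (Fin.cons 0 a : Fin (n + 1) → ℝ) i * x i,
            Fin.sum_univ_castSucc fun i => (Fin.snoc b 0 : Fin (n + 1) → ℝ) i * x i]
          simp only [Fin.cons_zero, Fin.cons_succ, Fin.snoc_castSucc, Fin.snoc_last, zero_mul,
            zero_add, add_zero, mul_neg, Finset.sum_neg_distrib]
          ring

theorem whittakerMajorant_lt_top (n : ℕ) (lam : Fin n → ℂ) (x : Fin n → ℝ) :
    whittakerMajorant n lam x < ∞ := by
  obtain ⟨C, p, -, h⟩ := exists_whittakerMajorant_le n lam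
  exact (h x).trans_lt ENNReal.ofReal_lt_top

theorem lintegral_baxterKernel_mul_whittakerMajorant {n : ℕ} {lam : Fin n → ℂ} {γ : ℂ}
    (h : ∀ i, 0 < (γ + lam i).re) (y : Fin n → ℝ) :
    ∫⁻ x, ‖baxterKernel γ x y‖ₑ * whittakerMajorant n lam x =
      (∏ i, ENNReal.ofReal (Real.Gamma (γ + lam i).re)) * whittakerMajorant n lam y := by
  induction n with
  | zero => simp [whittakerMajorant, baxterKernel, volume_pi]
  | succ n ih =>
    have hW := measurable_whittakerMajorant n fun i => lam i.castSucc
    calc ∫⁻ x, ‖baxterKernel γ x y‖ₑ * whittakerMajorant (n + 1) lam x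
        = ∫⁻ x, ∫⁻ z, ‖baxterKernel γ x y‖ₑ * (‖recKernel (lam (Fin.last n)) x z‖ₑ *
            whittakerMajorant n (fun i => lam i.castSucc) z) := by
          refine lintegral_congr fun x => ?_
          rw [lintegral_const_mul' _ _ enorm_ne_top]
          rfl
      _ = ∫⁻ z, (∫⁻ x, ‖baxterKernel γ x y‖ₑ * ‖recKernel (lam (Fin.last n)) x z‖ₑ) *
            whittakerMajorant n (fun i => lam i.castSucc) z := by
          rw [lintegral_lintegral_swap]
          · refine lintegral_congr fun z => ?_
            simp_rw [← mul_assoc]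
            rw [lintegral_mul_const' _ _ (whittakerMajorant_lt_top _ _ _).ne]
          · have h1 : Continuous fun p : (Fin (n + 1) → ℝ) × (Fin n → ℝ) =>
                baxterKernel γ p.1 y := by fun_prop
            have h2 : Continuous fun p : (Fin (n + 1) → ℝ) × (Fin n → ℝ) =>
                recKernel (lam (Fin.last n)) p.1 p.2 := by fun_prop
            exact (h1.measurable.enorm.mul
              (h2.measurable.enorm.mul (hW.comp measurable_snd))).aemeasurable
      _ = ENNReal.ofReal (Real.Gamma (γ + lam (Fin.last n)).re) * ∫⁻ z, ∫⁻ u,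
            ‖recKernel (lam (Fin.last n)) y u‖ₑ * (‖baxterKernel γ z u‖ₑ *
              whittakerMajorant n (fun i => lam i.castSucc) z) := by
          simp_rw [lintegral_baxterKernel_mul_recKernel (h (Fin.last n)), mul_assoc]
          rw [lintegral_const_mul' _ _ ENNReal.ofReal_ne_top]
          congr 1
          refine lintegral_congr fun z => ?_
          simp_rw [← mul_assoc]
          rw [lintegral_mul_const' _ _ (whittakerMajorant_lt_top _ _ _).ne]
      _ = ENNReal.ofReal (Real.Gamma (γ + lam (Fin.last n)).re) * ∫⁻ u,
            ‖recKernel (lam (Fin.last n)) y u‖ₑ * ∫⁻ z, ‖baxterKernel γ z u‖ₑ *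
              whittakerMajorant n (fun i => lam i.castSucc) z := by
          rw [lintegral_lintegral_swap]
          · congr 1
            refine lintegral_congr fun u => ?_
            rw [lintegral_const_mul' _ _ enorm_ne_top]
          · have h1 : Continuous fun p : (Fin n → ℝ) × (Fin n → ℝ) =>
                recKernel (lam (Fin.last n)) y p.2 := by fun_prop
            have h2 : Continuous fun p : (Fin n → ℝ) × (Fin n → ℝ) =>
                baxterKernel γ p.1 p.2 := by fun_prop
            exact (h1.measurable.enorm.mul
              (h2.measurable.enorm.mul (hW.comp measurable_fst))).aemeasurable
      _ = _ := by
          simp_rw [ih fun i => h i.castSucc]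
          have htop : ∏ i : Fin n, ENNReal.ofReal (Real.Gamma (γ + lam i.castSucc).re) ≠ ∞ :=
            ENNReal.prod_ne_top fun _ _ => ENNReal.ofReal_ne_top
          simp_rw [mul_left_comm _ (∏ i : Fin n, _)]
          rw [lintegral_const_mul' _ _ htop, Fin.prod_univ_castSucc, mul_left_comm, ← mul_assoc]
          rfl

theorem lintegral_baxterKernel_mul_whittakerMajorant_lt_top {n : ℕ} {lam : Fin n → ℂ} {γ : ℂ}
    (h : ∀ i, 0 < (γ + lam i).re) (y : Fin n → ℝ) :
    ∫⁻ x, ‖baxterKernel γ x y‖ₑ * whittakerMajorant n lam x < ∞ := by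
  rw [lintegral_baxterKernel_mul_whittakerMajorant h]
  exact ENNReal.mul_lt_top (ENNReal.prod_lt_top fun _ _ => ENNReal.ofReal_lt_top)
    (whittakerMajorant_lt_top n lam y)

theorem integrable_baxterKernel_mul_whittaker {n : ℕ} {lam : Fin n → ℂ} {γ : ℂ}
    (h : ∀ i, 0 < (γ + lam i).re) (y : Fin n → ℝ) :
    Integrable fun x => baxterKernel γ x y * whittaker n lam x := by
  have hB : Continuous fun x => baxterKernel γ x y := by fun_prop
  refine ⟨hB.aestronglyMeasurable.mul (stronglyMeasurable_whittaker n lam).aestronglyMeasurable,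
    (lintegral_mono fun x => ?_).trans_lt
      (lintegral_baxterKernel_mul_whittakerMajorant_lt_top h y)⟩
  rw [enorm_mul]
  gcongr
  exact enorm_whittaker_le n lam x

theorem integrable_prod_of_lintegral_lt_top {α β : Type*} [MeasurableSpace α] [MeasurableSpace β]
    {μ : Measure α} {ν : Measure β} [SFinite μ] [SFinite ν] {f : α × β → ℂ}
    (hf : StronglyMeasurable f) (h : ∫⁻ x, ∫⁻ y, ‖f (x, y)‖ₑ ∂ν ∂μ < ∞) :
    Integrable f (μ.prod ν) :=
  ⟨hf.aestronglyMeasurable, by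
    rw [HasFiniteIntegral, lintegral_prod _ hf.enorm.aemeasurable]; exact h⟩

/-- Whittaker functions are eigenfunctions of the Baxter operators. -/
theorem integral_baxterKernel_mul_whittaker {n : ℕ} {lam : Fin n → ℂ} {γ : ℂ}
    (h : ∀ i, 0 < (γ + lam i).re) (y : Fin n → ℝ) :
    ∫ x, baxterKernel γ x y * whittaker n lam x =
      (∏ i, Complex.Gamma (γ + lam i)) * whittaker n lam y := by
  induction n with
  | zero => simp [whittaker, baxterKernel, volume_pi, measureReal_def]
  | succ n ih =>
    have hψ := stronglyMeasurable_whittaker n fun i => lam i.castSucc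
    have hint₁ : Integrable (uncurry fun (x : Fin (n + 1) → ℝ) (z : Fin n → ℝ) =>
        baxterKernel γ x y * (recKernel (lam (Fin.last n)) x z *
          whittaker n (fun i => lam i.castSucc) z)) (volume.prod volume) := by
      refine integrable_prod_of_lintegral_lt_top ?_ ?_
      · have h1 : Continuous fun p : (Fin (n + 1) → ℝ) × (Fin n → ℝ) =>
            baxterKernel γ p.1 y := by fun_prop
        have h2 : Continuous fun p : (Fin (n + 1) → ℝ) × (Fin n → ℝ) =>
            recKernel (lam (Fin.last n)) p.1 p.2 := by fun_prop
        exact h1.stronglyMeasurable.mul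
          (h2.stronglyMeasurable.mul (hψ.comp_measurable measurable_snd))
      · refine (lintegral_mono fun x => ?_).trans_lt
          (lintegral_baxterKernel_mul_whittakerMajorant_lt_top h y)
        simp only [uncurry_apply_pair, enorm_mul]
        rw [lintegral_const_mul' _ _ enorm_ne_top]
        refine mul_le_mul_right (lintegral_mono fun z => ?_) _
        exact mul_le_mul_right (enorm_whittaker_le n _ z) _
    have hint₂ : Integrable (uncurry fun (u : Fin n → ℝ) (z : Fin n → ℝ) =>
        recKernel (lam (Fin.last n)) y u * (baxterKernel γ z u *
          whittaker n (fun i => lam i.castSucc) z)) (volume.prod volume) := by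
      refine integrable_prod_of_lintegral_lt_top ?_ ?_
      · have h1 : Continuous fun p : (Fin n → ℝ) × (Fin n → ℝ) =>
            recKernel (lam (Fin.last n)) y p.1 := by fun_prop
        have h2 : Continuous fun p : (Fin n → ℝ) × (Fin n → ℝ) =>
            baxterKernel γ p.2 p.1 := by fun_prop
        exact h1.stronglyMeasurable.mul
          (h2.stronglyMeasurable.mul (hψ.comp_measurable measurable_snd))
      · simp only [uncurry_apply_pair, enorm_mul]
        have hP : ∏ i : Fin n, ENNReal.ofReal (Real.Gamma (γ + lam i.castSucc).re) < ∞ :=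
          ENNReal.prod_lt_top fun _ _ => ENNReal.ofReal_lt_top
        refine lt_of_le_of_lt ?_
          (ENNReal.mul_lt_top hP (whittakerMajorant_lt_top (n + 1) lam y))
        rw [whittakerMajorant, ← lintegral_const_mul' _ _ hP.ne]
        refine lintegral_mono fun u => ?_
        rw [lintegral_const_mul' _ _ enorm_ne_top, mul_left_comm,
          ← lintegral_baxterKernel_mul_whittakerMajorant fun i => h i.castSucc]
        refine mul_le_mul_right (lintegral_mono fun z => ?_) _
        exact mul_le_mul_right (enorm_whittaker_le n _ z) _
    calc ∫ x, baxterKernel γ x y * whittaker (n + 1) lam x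
        = ∫ x, ∫ z, baxterKernel γ x y * (recKernel (lam (Fin.last n)) x z *
            whittaker n (fun i => lam i.castSucc) z) := by
          simp_rw [integral_const_mul]
          rfl
      _ = ∫ z, (∫ x, baxterKernel γ x y * recKernel (lam (Fin.last n)) x z) *
            whittaker n (fun i => lam i.castSucc) z := by
          rw [integral_integral_swap hint₁]
          simp_rw [← mul_assoc, integral_mul_const]
      _ = Complex.Gamma (γ + lam (Fin.last n)) * ∫ z, ∫ u,
            recKernel (lam (Fin.last n)) y u * (baxterKernel γ z u *
              whittaker n (fun i => lam i.castSucc) z) := by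
          simp_rw [integral_baxterKernel_mul_recKernel (h (Fin.last n)), ← mul_assoc,
            integral_mul_const, mul_assoc, integral_const_mul]
      _ = Complex.Gamma (γ + lam (Fin.last n)) * ∫ u, recKernel (lam (Fin.last n)) y u *
            ∫ z, baxterKernel γ z u * whittaker n (fun i => lam i.castSucc) z := by
          rw [← integral_integral_swap hint₂]
          simp_rw [integral_const_mul]
      _ = _ := by
          simp_rw [ih fun i => h i.castSucc, mul_left_comm _ (∏ i : Fin n, _)]
          rw [integral_const_mul, Fin.prod_univ_castSucc, mul_left_comm, ← mul_assoc]
          rfl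

end Whittaker

section Unfolding

theorem measurable_snoc_row (n : ℕ) :
    Measurable fun p : GTArray (n + 1) × (Fin (n + 1) → ℝ) =>
      (Fin.snoc (α := fun k : Fin (n + 1) => Fin (k.1 + 1) → ℝ) p.1 p.2 : GTArray (n + 2)) := by
  refine measurable_pi_lambda _ fun k : Fin (n + 1) => ?_
  cases k using Fin.lastCases with
  | last =>
    exact Eq.subst (motive := fun f => Measurable f) (funext fun p =>
      (Fin.snoc_last (α := fun k : Fin (n + 1) => Fin (k.1 + 1) → ℝ) p.2 p.1).symm) measurable_snd
  | cast k =>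
    exact Eq.subst (motive := fun f => Measurable f) (funext fun p =>
      (Fin.snoc_castSucc (α := fun k : Fin (n + 1) => Fin (k.1 + 1) → ℝ) p.2 p.1 k).symm)
      ((measurable_pi_apply k).comp measurable_fst)

/-- Splitting off the last row of a triangular array. -/
noncomputable def splitLastRow (n : ℕ) :
    GTArray (n + 2) ≃ᵐ GTArray (n + 1) × (Fin (n + 1) → ℝ) where
  toFun z := (fun k : Fin n => z (Fin.castSucc k), z (Fin.last n))
  invFun p := Fin.snoc (α := fun k : Fin (n + 1) => Fin (k.1 + 1) → ℝ) p.1 p.2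
  left_inv z := Fin.snoc_init_self (α := fun k : Fin (n + 1) => Fin (k.1 + 1) → ℝ) z
  right_inv p := Prod.ext (Fin.init_snoc (α := fun k : Fin (n + 1) => Fin (k.1 + 1) → ℝ) p.2 p.1)
    (Fin.snoc_last (α := fun k : Fin (n + 1) => Fin (k.1 + 1) → ℝ) p.2 p.1)
  measurable_toFun := by
    refine Measurable.prodMk ?_ (measurable_pi_apply _)
    exact measurable_pi_lambda _ fun k => measurable_pi_apply _
  measurable_invFun := measurable_snoc_row n

theorem splitLastRow_symm_castSucc {n : ℕ} (p : GTArray (n + 1) × (Fin (n + 1) → ℝ)) (k : Fin n) :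
    (splitLastRow n).symm p (Fin.castSucc k) = p.1 k :=
  Fin.snoc_castSucc (α := fun k : Fin (n + 1) => Fin (k.1 + 1) → ℝ) p.2 p.1 k

theorem splitLastRow_symm_last {n : ℕ} (p : GTArray (n + 1) × (Fin (n + 1) → ℝ)) :
    (splitLastRow n).symm p (Fin.last n) = p.2 :=
  Fin.snoc_last (α := fun k : Fin (n + 1) => Fin (k.1 + 1) → ℝ) p.2 p.1

theorem measurePreserving_splitLastRow_symm (n : ℕ) :
    MeasurePreserving (splitLastRow n).symm (volume.prod volume) volume := by
  refine ⟨(splitLastRow n).symm.measurable, ?_⟩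
  refine (Measure.pi_eq fun s _ => ?_).symm
  have hset : (splitLastRow n).symm ⁻¹' univ.pi s =
      (univ.pi fun k : Fin n => s (Fin.castSucc k)) ×ˢ s (Fin.last n) := by
    ext p
    simp only [mem_preimage, mem_univ_pi, mem_prod]
    exact Fin.forall_fin_succ'.trans (by
      simp only [splitLastRow_symm_castSucc, splitLastRow_symm_last])
  rw [MeasurableEquiv.map_apply, hset, Measure.prod_prod]
  exact (congrArg (· * _) (Measure.pi_pi _ _)).trans
    (Fin.prod_univ_castSucc fun k : Fin (n + 1) => (volume (s k))).symm

/-- The integrand of the Whittaker function `Psi` in logarithmic coordinates. -/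
noncomputable def logIntegrand (n : ℕ) (lam : Fin n → ℂ) (t : Fin n → ℝ) (z : GTArray n) : ℂ :=
  wfun n lam (fun i => Real.exp (t i)) (fun k j => Real.exp (z k j)) *
    (Real.exp (-Ffun n (fun i => Real.exp (t i)) fun k j => Real.exp (z k j)) : ℂ)

theorem Psi_exp (n : ℕ) (lam : Fin n → ℂ) (t : Fin n → ℝ) :
    Psi n lam (fun i => Real.exp (t i)) = ∫ z, logIntegrand n lam t z := by
  have hpos : MeasurableSet (GTpos n) := by
    have hset : GTpos n =
        univ.pi fun k : Fin (n - 1) => univ.pi fun _ : Fin (k.1 + 1) => Ioi (0 : ℝ) := by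
      ext; simp [GTpos]
    rw [hset]
    exact .univ_pi fun _ => .univ_pi fun _ => measurableSet_Ioi
  have hd : Measurable (GTdens n) := by
    unfold GTdens
    fun_prop
  exact (setIntegral_mul_density (measurableEmbedding_pi_pi_exp n) hpos hd
    (fun z hz => Finset.prod_nonneg fun k _ =>
      Finset.prod_nonneg fun j _ => (inv_pos.2 (hz k j)).le)
    (map_pi_pi_exp_volume n) _).2

theorem measurable_Zent (n k j : ℕ) :
    Measurable fun p : (Fin n → ℝ) × GTArray n => Zent n p.1 p.2 k j := by
  unfold Zent
  split_ifs <;> fun_prop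

theorem measurable_logIntegrand (n : ℕ) (lam : Fin n → ℂ) :
    Measurable fun p : (Fin n → ℝ) × GTArray n => logIntegrand n lam p.1 p.2 := by
  have h : Measurable fun p : (Fin n → ℝ) × GTArray n =>
      ((fun i => Real.exp (p.1 i), fun k j => Real.exp (p.2 k j)) : (Fin n → ℝ) × GTArray n) := by
    fun_prop
  have hZ (k j : ℕ) := (measurable_Zent n k j).comp h
  simp only [comp_def] at hZ
  unfold logIntegrand wfun Ffun
  fun_prop

theorem Zent_of_lt {n k j : ℕ} (hk : k < n - 1) (hj : j < k + 1) (x : Fin n → ℝ) (z : GTArray n) :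
    Zent n x z k j = z ⟨k, hk⟩ ⟨j, hj⟩ := by
  simp [Zent, hk, hj]

theorem Zent_last {n j : ℕ} (hj : j < n + 1) (x : Fin (n + 1) → ℝ) (z : GTArray (n + 1)) :
    Zent (n + 1) x z n j = x ⟨j, hj⟩ := by
  simp [Zent, hj]

theorem Zent_splitLastRow_symm {n k j : ℕ} (hk : k < n + 1) (hj : j < k + 1)
    (x : Fin (n + 2) → ℝ) (p : GTArray (n + 1) × (Fin (n + 1) → ℝ)) :
    Zent (n + 2) x ((splitLastRow n).symm p) k j = Zent (n + 1) p.2 p.1 k j := by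
  rw [Zent_of_lt (show k < n + 2 - 1 from hk) hj]
  obtain hk' | rfl := Nat.lt_succ_iff_lt_or_eq.1 hk
  · rw [Zent_of_lt (show k < n + 1 - 1 from hk') hj]
    exact congrFun (splitLastRow_symm_castSucc p ⟨k, hk'⟩) ⟨j, hj⟩
  · rw [Zent_last hj]
    exact congrFun (splitLastRow_symm_last p) ⟨j, hj⟩

theorem wfun_splitLastRow_symm {n : ℕ} (lam : Fin (n + 2) → ℂ) (x : Fin (n + 2) → ℝ)
    (p : GTArray (n + 1) × (Fin (n + 1) → ℝ)) :
    wfun (n + 2) lam x ((splitLastRow n).symm p) =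
      wfun (n + 1) (fun i => lam i.castSucc) p.2 p.1 *
        Complex.exp (-lam (Fin.last (n + 1)) * (Real.log ((∏ i, x i) / ∏ i, p.2 i) : ℂ)) := by
  unfold wfun
  rw [Finset.prod_range_succ]
  congr 1
  · refine Finset.prod_congr rfl fun k hk => ?_
    have hk := Finset.mem_range.1 hk
    rw [dif_pos hk, dif_pos (hk.trans (Nat.lt_succ_self _)),
      Finset.prod_congr rfl fun j hj => Zent_splitLastRow_symm hk (Finset.mem_range.1 hj) x p,
      Finset.prod_congr rfl fun j hj => Zent_splitLastRow_symm (k := k - 1) (by omega)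
        (by have := Finset.mem_range.1 hj; omega) x p]
    rfl
  · rw [dif_pos (Nat.lt_succ_self _), Finset.prod_range, Finset.prod_range,
      Finset.prod_congr rfl fun i _ => Zent_last i.2 x _,
      Finset.prod_congr rfl fun i _ => Zent_splitLastRow_symm (k := n + 1 - 1) (by omega) i.2 x p,
      Finset.prod_congr rfl fun (i : Fin (n + 1)) _ =>
        show Zent (n + 1) p.2 p.1 (n + 1 - 1) i = p.2 i from Zent_last i.2 p.2 p.1]
    rfl

theorem Ffun_splitLastRow_symm {n : ℕ} (x : Fin (n + 2) → ℝ)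
    (p : GTArray (n + 1) × (Fin (n + 1) → ℝ)) :
    Ffun (n + 2) x ((splitLastRow n).symm p) =
      Ffun (n + 1) p.2 p.1 + ∑ i : Fin (n + 1), (x i.succ / p.2 i + p.2 i / x i.castSucc) := by
  unfold Ffun
  refine (Finset.sum_range_succ _ n).trans (congrArg₂ _ ?_ ?_)
  · refine Finset.sum_congr rfl fun k hk => Finset.sum_congr rfl fun j hj => ?_
    have hk := Finset.mem_range.1 hk
    have hj := Finset.mem_range.1 hj
    rw [Zent_splitLastRow_symm (by omega) (by omega), Zent_splitLastRow_symm (by omega) (by omega),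
      Zent_splitLastRow_symm (by omega) (by omega)]
  · rw [Finset.sum_range]
    refine Finset.sum_congr rfl fun j _ => ?_
    rw [Zent_splitLastRow_symm (by omega) j.2, Zent_last (j := j.1) j.2, Zent_last (by omega),
      Zent_last (by omega)]
    rfl

theorem logIntegrand_splitLastRow_symm {n : ℕ} (lam : Fin (n + 2) → ℂ) (t : Fin (n + 2) → ℝ)
    (p : GTArray (n + 1) × (Fin (n + 1) → ℝ)) :
    logIntegrand (n + 2) lam t ((splitLastRow n).symm p) =
      recKernel (lam (Fin.last (n + 1))) t p.2 *
        logIntegrand (n + 1) (fun i => lam i.castSucc) p.2 p.1 := by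
  have hexp : ((fun k j => Real.exp ((splitLastRow n).symm p k j)) : GTArray (n + 2)) =
      (splitLastRow n).symm (fun k j => Real.exp (p.1 k j), fun j => Real.exp (p.2 j)) := by
    funext k
    induction k using Fin.lastCases with
    | last =>
      refine .trans ?_ (splitLastRow_symm_last _).symm
      exact congrArg (fun v j => Real.exp (v j)) (splitLastRow_symm_last p)
    | cast k =>
      refine .trans ?_ (splitLastRow_symm_castSucc _ k).symm
      exact congrArg (fun v j => Real.exp (v j)) (splitLastRow_symm_castSucc p k)
  unfold logIntegrand
  rw [hexp, wfun_splitLastRow_symm, Ffun_splitLastRow_symm, recKernel]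
  simp only [← Real.exp_sum, ← Real.exp_sub, Real.log_exp, neg_add, Real.exp_add,
    Complex.ofReal_mul, sub_eq_add_neg _ (Complex.ofReal _), Complex.exp_add]
  push_cast
  rw [show -lam (Fin.last (n + 1)) * ((∑ i, (t i : ℂ)) - ∑ i, (p.2 i : ℂ)) =
    lam (Fin.last (n + 1)) * ((∑ i, (p.2 i : ℂ)) - ∑ i, (t i : ℂ)) by ring]
  ring

theorem logIntegrand_one (lam : Fin 1 → ℂ) (t : Fin 1 → ℝ) (z : GTArray 1) (w : Fin 0 → ℝ) :
    logIntegrand 1 lam t z = recKernel (lam 0) t w := by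
  simp [logIntegrand, wfun, Ffun, Zent, recKernel]

theorem lintegral_logIntegrand (n : ℕ) (lam : Fin (n + 1) → ℂ) (t : Fin (n + 1) → ℝ) :
    ∫⁻ z, ‖logIntegrand (n + 1) lam t z‖ₑ = whittakerMajorant (n + 1) lam t := by
  induction n with
  | zero =>
    have : IsEmpty (Fin (0 + 1 - 1)) := inferInstanceAs (IsEmpty (Fin 0))
    rw [Measure.volume_pi_eq_dirac]
    simp only [lintegral_dirac, whittakerMajorant, mul_one]
    rw [Measure.volume_pi_eq_dirac, lintegral_dirac, logIntegrand_one]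
    rfl
  | succ n ih =>
    rw [← (measurePreserving_splitLastRow_symm n).lintegral_comp_emb
      (splitLastRow n).symm.measurableEmbedding]
    simp only [logIntegrand_splitLastRow_symm, enorm_mul]
    rw [lintegral_prod_symm' _ (by
      refine .mul (Continuous.measurable (by fun_prop)).enorm
        ((measurable_logIntegrand _ _).comp measurable_swap).enorm)]
    conv_rhs => rw [whittakerMajorant]
    refine lintegral_congr fun z => ?_
    refine (lintegral_const_mul ‖recKernel (lam (Fin.last (n + 1))) t z‖ₑ
      ((measurable_logIntegrand _ _).comp measurable_prodMk_left).enorm).trans ?_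
    exact congrArg _ (ih _ _)

theorem integral_logIntegrand (n : ℕ) (lam : Fin (n + 1) → ℂ) (t : Fin (n + 1) → ℝ) :
    ∫ z, logIntegrand (n + 1) lam t z = whittaker (n + 1) lam t := by
  induction n with
  | zero =>
    have : IsEmpty (Fin (0 + 1 - 1)) := inferInstanceAs (IsEmpty (Fin 0))
    rw [Measure.volume_pi_eq_dirac]
    simp only [integral_dirac, whittaker, mul_one]
    rw [Measure.volume_pi_eq_dirac, integral_dirac, logIntegrand_one]
    rfl
  | succ n ih =>
    rw [← (measurePreserving_splitLastRow_symm n).integral_comp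
      (splitLastRow n).symm.measurableEmbedding]
    have hint : Integrable (fun p : (Fin (n + 1) → ℝ) × GTArray (n + 1) =>
        recKernel (lam (Fin.last (n + 1))) t p.1 *
          logIntegrand (n + 1) (fun i => lam i.castSucc) p.1 p.2) (volume.prod volume) := by
      refine integrable_prod_of_lintegral_lt_top (Measurable.stronglyMeasurable ?_) ?_
      · exact .mul (Continuous.measurable (by fun_prop)) (measurable_logIntegrand _ _)
      · refine lt_of_eq_of_lt ?_ (whittakerMajorant_lt_top (n + 2) lam t)
        rw [whittakerMajorant]
        refine lintegral_congr fun z => ?_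
        simp only [enorm_mul]
        refine (lintegral_const_mul _
          ((measurable_logIntegrand _ _).comp measurable_prodMk_left).enorm).trans ?_
        exact congrArg _ (lintegral_logIntegrand _ _ _)
    simp only [logIntegrand_splitLastRow_symm]
    refine (integral_prod_symm _ hint.swap).trans ?_
    conv_rhs => rw [whittaker]
    refine integral_congr_ae (.of_forall fun z => ?_)
    exact (integral_const_mul (recKernel (lam (Fin.last (n + 1))) t z) _).trans
      (congrArg _ (ih _ _))

theorem Psi_exp_eq_whittaker (n : ℕ) (lam : Fin (n + 1) → ℂ) (t : Fin (n + 1) → ℝ) :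
    Psi (n + 1) lam (fun i => Real.exp (t i)) = whittaker (n + 1) lam t :=
  (Psi_exp _ _ _).trans (integral_logIntegrand _ _ _)

theorem baxterQ_exp (n : ℕ) (γ : ℂ) (x y : Fin (n + 1) → ℝ) :
    baxterQ (n + 1) γ (fun i => Real.exp (x i)) (fun i => Real.exp (y i)) =
      baxterKernel γ x y := by
  have hsum : ∑ i ∈ Finset.range n,
      (if hi : i + 1 < n + 1 then Real.exp (x ⟨i + 1, hi⟩) else 0) /
        (if hi : i < n + 1 then Real.exp (y ⟨i, hi⟩) else 1) =
      ∑ i : Fin (n + 1), expEntry x (i + 1) * Real.exp (-y i) := by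
    rw [Fin.sum_univ_castSucc, Finset.sum_range]
    simp only [Fin.val_last, expEntry_self, zero_mul, add_zero]
    refine Finset.sum_congr rfl fun i _ => ?_
    rw [dif_pos (by omega), dif_pos (by omega), Real.exp_neg, ← div_eq_mul_inv, expEntry,
      dif_pos (by simp)]
    rfl
  unfold baxterQ baxterKernel
  rw [Nat.add_sub_cancel, hsum]
  simp only [← Real.exp_sub, ← Real.exp_sum, Real.log_exp, Finset.sum_sub_distrib,
    Complex.ofReal_exp, ← Complex.exp_add, Finset.sum_add_distrib]
  push_cast
  ring_nf

end Unfolding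

end Whittaker

/-- Theorem 5.4 (Gerasimov–Lebedev–Oblezin; the Pieri-type identity): the Baxter
operator acts on the Whittaker function by the scalar `Π Γ(γ + λᵢ)`:
`∫_{ℝ_{>0}ⁿ} Qⁿ_γ(x,y) Ψⁿ_λ(x) Π dxᵢ/xᵢ = (Π Γ(γ + λᵢ)) Ψⁿ_λ(y)`,
the integrand being absolutely integrable. -/
theorem whittaker_pieri_identity (n : ℕ) (hn : 1 ≤ n) (lam : Fin n → ℂ) (γ : ℂ)
    (hre : ∀ i, 0 < (γ + lam i).re) (y : Fin n → ℝ) (hy : ∀ i, 0 < y i) :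
    IntegrableOn
      (fun x : Fin n → ℝ =>
        baxterQ n γ x y * Psi n lam x * ((∏ i, (x i)⁻¹ : ℝ) : ℂ))
      {x | ∀ i, 0 < x i} ∧
    ∫ x in {x : Fin n → ℝ | ∀ i, 0 < x i},
        baxterQ n γ x y * Psi n lam x * ((∏ i, (x i)⁻¹ : ℝ) : ℂ) =
      (∏ i, Complex.Gamma (γ + lam i)) * Psi n lam y := by
  obtain ⟨m, rfl⟩ : ∃ m, n = m + 1 := ⟨n - 1, by omega⟩
  obtain ⟨s, rfl⟩ : ∃ s : Fin (m + 1) → ℝ, y = fun i => Real.exp (s i) :=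
    ⟨fun i => Real.log (y i), funext fun i => (Real.exp_log (hy i)).symm⟩
  have hpos : MeasurableSet {x : Fin (m + 1) → ℝ | ∀ i, 0 < x i} := by
    simp only [Set.ofPred_forall]
    exact .iInter fun i => measurableSet_lt measurable_const (measurable_pi_apply i)
  have h := Whittaker.setIntegral_mul_density (Whittaker.measurableEmbedding_pi_exp (m + 1)) hpos
    (d := fun x => ∏ i, (x i)⁻¹) (by fun_prop)
    (fun x hx => Finset.prod_nonneg fun i _ => (inv_pos.2 (hx i)).le)
    (Whittaker.map_pi_exp_volume (m + 1))
    fun x => baxterQ (m + 1) γ x (fun i => Real.exp (s i)) * Psi (m + 1) lam x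
  simp only [Whittaker.baxterQ_exp, Whittaker.Psi_exp_eq_whittaker] at h ⊢
  exact ⟨h.1.2 (Whittaker.integrable_baxterKernel_mul_whittaker hre s),
    h.2.trans (Whittaker.integral_baxterKernel_mul_whittaker hre s)⟩
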